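/- arXiv:2204.13538 — 2 statements merged into one kernel-verified Lean document; each statement's English description precedes it below -/
import Mathlib

section
/- Let p be a prime, m ≥ 1, and 0 ≤ w ≤ m-1. Let e1, e2 ∈ {0,...,p-1}^w with D = Σ_{α=0}^{w-1} (e_{2,α} − e_{1,α}) p^{w-1-α} ≥ 0, and for 0 ≤ τ ≤ p^m − 1 let B_τ(e1,e2) = {(γ,δ) : 0 ≤ γ ≤ p^m − τ − 1, δ = γ + τ, the first w base-p digits of γ equal e1 and the first w base-p digits of δ equal e2}. If τ = p^{m-w}(D−1) + τ1 with 1 ≤ τ1 ≤ p^{m-w} and τ ≥ 0, then |B_τ(e1,e2)| = τ1; if τ = p^{m-w}D + τ2 with 1 ≤ τ2 ≤ p^{m-w} − 1 and τ ≤ p^m − 1, then |B_τ(e1,e2)| = p^{m-w} − τ2. -/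
namespace QCCS

/-- `Λ(e1,e2) = Σ_{a=0}^{w-1} (e_{2,a} - e_{1,a}) p^{w-1-a}`, digits regarded as integers. -/
def Dval (p w : ℕ) (e1 e2 : Fin w → Fin p) : ℤ :=
  ∑ a : Fin w, (((e2 a : ℕ) : ℤ) - ((e1 a : ℕ) : ℤ)) * (p : ℤ) ^ (w - 1 - (a : ℕ))

/-- The set `B_τ(e1,e2)` of pairs `(γ,δ)` with `δ = γ + τ`, `0 ≤ γ ≤ p^m - τ - 1`,
the first `w` base-`p` digits of `γ` equal to `e1` and those of `δ` equal to `e2`. -/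
def Bset (p m w : ℕ) (e1 e2 : Fin w → Fin p) (τ : ℕ) : Finset (ℕ × ℕ) :=
  Finset.filter (fun gd =>
      gd.2 = gd.1 + τ ∧ gd.1 ≤ p ^ m - τ - 1 ∧
      ∀ a : Fin w, gd.1 / p ^ (m - 1 - (a : ℕ)) % p = (e1 a : ℕ)
        ∧ gd.2 / p ^ (m - 1 - (a : ℕ)) % p = (e2 a : ℕ))
    (Finset.range (p ^ m) ×ˢ Finset.range (p ^ m))

/-- the value of a digit vector -/
def Nval (p w : ℕ) (e : Fin w → Fin p) : ℕ :=
  ∑ a : Fin w, (e a : ℕ) * p ^ (w - 1 - (a : ℕ))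

theorem Nval_succ (p w : ℕ) (e : Fin (w + 1) → Fin p) :
    Nval p (w + 1) e = p * Nval p w (fun a => e a.castSucc) + (e (Fin.last w) : ℕ) := by
  unfold Nval
  rw [Fin.sum_univ_castSucc, Finset.mul_sum]
  congr 1
  · refine Finset.sum_congr rfl fun a _ => ?_
    have ha := a.isLt
    have h : w + 1 - 1 - ((a.castSucc : Fin (w + 1)) : ℕ) = (w - 1 - (a : ℕ)) + 1 := by
      simp only [Fin.val_castSucc]; omega
    rw [h, pow_succ]; ring
  · simp

theorem Nval_lt (p w : ℕ) (e : Fin w → Fin p) : Nval p w e < p ^ w := by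
  induction w with
  | zero => simp [Nval]
  | succ w ih =>
    rw [Nval_succ, pow_succ]
    have h1 := ih (fun a => e a.castSucc)
    have h2 := (e (Fin.last w)).isLt
    nlinarith

theorem digits_iff (p w : ℕ) (hp : 0 < p) (e : Fin w → Fin p) (n : ℕ) (hn : n < p ^ w) :
    (∀ a : Fin w, n / p ^ (w - 1 - (a : ℕ)) % p = (e a : ℕ)) ↔ n = Nval p w e := by
  induction w generalizing n with
  | zero => simp at hn; simp [Nval, hn]
  | succ w ih =>
    have hlt : n / p < p ^ w := by
      rw [Nat.div_lt_iff_lt_mul hp, ← pow_succ]; exact hn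
    have key := ih (fun a => e a.castSucc) (n / p) hlt
    have hc : ∀ a : Fin w, n / p ^ (w + 1 - 1 - ((a.castSucc : Fin (w + 1)) : ℕ))
        = n / p / p ^ (w - 1 - (a : ℕ)) := by
      intro a
      have ha := a.isLt
      have h : w + 1 - 1 - ((a.castSucc : Fin (w + 1)) : ℕ) = (w - 1 - (a : ℕ)) + 1 := by
        simp only [Fin.val_castSucc]; omega
      rw [h, pow_succ', Nat.div_div_eq_div_mul]
    rw [Fin.forall_fin_succ', Nval_succ]
    simp only [hc]
    rw [key]
    have h2 := (e (Fin.last w)).isLt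
    have hl : n / p ^ (w + 1 - 1 - ((Fin.last w : Fin (w + 1)) : ℕ)) = n := by simp
    rw [hl]
    constructor
    · rintro ⟨h, h'⟩
      rw [← h, ← h', Nat.div_add_mod]
    · intro h
      rw [h]
      constructor
      · rw [Nat.mul_add_div hp, Nat.div_eq_of_lt h2, add_zero]
      · rw [Nat.mul_add_mod, Nat.mod_eq_of_lt h2]

theorem first_iff (p m w : ℕ) (hp : 0 < p) (hw : w ≤ m) (e : Fin w → Fin p) (n : ℕ)
    (hn : n < p ^ m) :
    (∀ a : Fin w, n / p ^ (m - 1 - (a : ℕ)) % p = (e a : ℕ)) ↔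
      n / p ^ (m - w) = Nval p w e := by
  have hlt : n / p ^ (m - w) < p ^ w := by
    rw [Nat.div_lt_iff_lt_mul (by positivity), ← pow_add]
    rwa [show w + (m - w) = m by omega]
  rw [← digits_iff p w hp e _ hlt]
  refine forall_congr' fun a => ?_
  have ha := a.isLt
  rw [Nat.div_div_eq_div_mul, ← pow_add, show m - w + (w - 1 - (a : ℕ)) = m - 1 - a by omega]

theorem Dval_eq (p w : ℕ) (e1 e2 : Fin w → Fin p) :
    Dval p w e1 e2 = (Nval p w e2 : ℤ) - Nval p w e1 := by
  unfold Dval Nval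
  push_cast
  rw [← Finset.sum_sub_distrib]
  exact Finset.sum_congr rfl fun a _ => by ring

theorem mem_Bset (p m w : ℕ) (hp : 0 < p) (hw : w ≤ m) (e1 e2 : Fin w → Fin p) (τ : ℕ)
    (x : ℕ × ℕ) :
    x ∈ Bset p m w e1 e2 τ ↔ x.2 = x.1 + τ ∧
      (Nval p w e1 * p ^ (m - w) ≤ x.1 ∧ x.1 < Nval p w e1 * p ^ (m - w) + p ^ (m - w)) ∧
      (Nval p w e2 * p ^ (m - w) ≤ x.2 ∧ x.2 < Nval p w e2 * p ^ (m - w) + p ^ (m - w)) := by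
  have hq : 0 < p ^ (m - w) := by positivity
  have hpm : p ^ w * p ^ (m - w) = p ^ m := by
    rw [← pow_add, show w + (m - w) = m by omega]
  have hdiv : ∀ n N : ℕ, n / p ^ (m - w) = N ↔
      (N * p ^ (m - w) ≤ n ∧ n < N * p ^ (m - w) + p ^ (m - w)) := by
    intro n N
    rw [Nat.div_eq_iff hq]
    omega
  have hb : ∀ e : Fin w → Fin p, Nval p w e * p ^ (m - w) + p ^ (m - w) ≤ p ^ m := by
    intro e
    have := Nval_lt p w e
    rw [← hpm]
    nlinarith
  unfold Bset
  simp only [Finset.mem_filter, Finset.mem_product, Finset.mem_range, forall_and]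
  constructor
  · rintro ⟨⟨h1, h2⟩, h3, -, h5, h6⟩
    rw [first_iff p m w hp hw e1 _ h1, hdiv] at h5
    rw [first_iff p m w hp hw e2 _ h2, hdiv] at h6
    exact ⟨h3, h5, h6⟩
  · rintro ⟨h3, h5, h6⟩
    have h1 : x.1 < p ^ m := lt_of_lt_of_le h5.2 (hb e1)
    have h2 : x.2 < p ^ m := lt_of_lt_of_le h6.2 (hb e2)
    refine ⟨⟨h1, h2⟩, h3, by omega, ?_, ?_⟩
    · rwa [first_iff p m w hp hw e1 _ h1, hdiv]
    · rwa [first_iff p m w hp hw e2 _ h2, hdiv]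

theorem card_Bset (p m w : ℕ) (hp : 0 < p) (hw : w ≤ m) (e1 e2 : Fin w → Fin p) (τ a b : ℕ)
    (h : ∀ g : ℕ, (a ≤ g ∧ g < b) ↔
      (Nval p w e1 * p ^ (m - w) ≤ g ∧ g < Nval p w e1 * p ^ (m - w) + p ^ (m - w)) ∧
      (Nval p w e2 * p ^ (m - w) ≤ g + τ ∧
        g + τ < Nval p w e2 * p ^ (m - w) + p ^ (m - w))) :
    (Bset p m w e1 e2 τ).card = b - a := by
  have : Bset p m w e1 e2 τ = (Finset.Ico a b).image (fun g => (g, g + τ)) := by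
    ext ⟨x, y⟩
    rw [mem_Bset p m w hp hw]
    simp only [Finset.mem_image, Finset.mem_Ico, Prod.mk.injEq]
    constructor
    · rintro ⟨h1, h2⟩
      subst h1
      exact ⟨x, (h x).2 h2, rfl, rfl⟩
    · rintro ⟨g, hg, rfl, rfl⟩
      exact ⟨rfl, (h g).1 hg⟩
  rw [this, Finset.card_image_of_injective _ (fun x y hxy => (Prod.mk.inj hxy).1), Nat.card_Ico]

theorem stmt13 {p m w : ℕ} (hp : p.Prime) (hm : 1 ≤ m) (hw : w ≤ m - 1)
    (e1 e2 : Fin w → Fin p) (hD : 0 ≤ Dval p w e1 e2)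
    (τ : ℕ) (hτ : τ ≤ p ^ m - 1) :
    (∀ τ1 : ℕ, 1 ≤ τ1 → τ1 ≤ p ^ (m - w) →
      (τ : ℤ) = (p : ℤ) ^ (m - w) * (Dval p w e1 e2 - 1) + τ1 →
      (Bset p m w e1 e2 τ).card = τ1)
    ∧ (∀ τ2 : ℕ, 1 ≤ τ2 → τ2 ≤ p ^ (m - w) - 1 →
      (τ : ℤ) = (p : ℤ) ^ (m - w) * Dval p w e1 e2 + τ2 →
      (Bset p m w e1 e2 τ).card = p ^ (m - w) - τ2) := by
  have hp0 := hp.pos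
  have hwm : w ≤ m := by omega
  have hq : 0 < p ^ (m - w) := by positivity
  have hcard := card_Bset p m w hp0 hwm e1 e2 τ
  rw [Dval_eq] at hD ⊢
  generalize Nval p w e1 = A at *
  generalize Nval p w e2 = B at *
  have hcast : (p : ℤ) ^ (m - w) = ((p ^ (m - w) : ℕ) : ℤ) := by push_cast; rfl
  rw [hcast]
  generalize p ^ (m - w) = q at *
  constructor
  · intro t h1 h2 h3
    have h4 : τ + A * q + q = B * q + t := by
      zify; linarith
    rw [hcard (A * q + (q - t)) (A * q + q) (by intro g; omega)]
    omega
  · intro t h1 h2 h3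
    have h4 : τ + A * q = B * q + t := by
      zify; linarith
    rw [hcard (A * q) (A * q + (q - t)) (by intro g; omega)]
    omega
end QCCS
end

section
/- Let p be a prime, λ a positive multiple of p, m ≥ 1, 0 ≤ n ≤ m-1, J = {j_0,...,j_{n-1}} ⊆ {0,...,m-1}, and let f : {0,1,...,p-1}^m → ℤ_λ be any multivariate function. Let k ∈ {1,...,p-1}, let l, l' be (not necessarily distinct) indices in {0,...,m-1} \ J, and for d_n, t_n ∈ {0,...,p-1} define f_{d_n,t_n} = f + (λ/p)(k d_n x_l + t_n x_{l'}). Then for every c ∈ {0,...,p-1}^n and every t_n, t'_n ∈ {0,...,p-1}, Σ_{d_n=0}^{p-1} Θ(ψ(f_{d_n,t_n}|_{x_J=c}), ψ(f_{d_n,t'_n}|_{x_J=c}))(0) equals p^{m-n+1} if t_n = t'_n and equals 0 if t_n ≠ t'_n. -/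
open Finset

noncomputable section

namespace QCCS

/-- The base-`p` digit vector (most significant digit first) of a natural number `i`,
viewed as an element of `{0,...,p-1}^m`. -/
def digitVec (p m : ℕ) [NeZero p] (i : ℕ) : Fin m → Fin p :=
  fun a => ⟨i / p ^ (m - 1 - (a : ℕ)) % p, Nat.mod_lt _ (Nat.pos_of_ne_zero (NeZero.ne p))⟩

/-- The primitive `lam`-th root of unity `exp(2πi/lam)`. -/
def zeta (lam : ℕ) : ℂ := Complex.exp (2 * Real.pi * Complex.I / lam)

/-- The complex sequence `ψ(f)` of length `p^m` associated with a multivariate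
function `f : {0,...,p-1}^m → ℤ_lam`; entry `i` is `ξ_lam^(f(i_0,...,i_{m-1}))`. -/
def psi (p lam m : ℕ) [NeZero p] (f : (Fin m → Fin p) → ZMod lam) : ℕ → ℂ :=
  fun i => zeta lam ^ (f (digitVec p m i)).val

/-- The restricted sequence `ψ(f|_{x_J = c})`: entry `i` is `ξ_lam^(f(i_0,...,i_{m-1}))`
if the digits of `i` at the positions listed by `J` agree with `c`, and `0` otherwise. -/
def psiRes (p lam m n : ℕ) [NeZero p] (f : (Fin m → Fin p) → ZMod lam)
    (J : Fin n → Fin m) (c : Fin n → Fin p) : ℕ → ℂ :=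
  fun i => if ∀ a, digitVec p m i (J a) = c a then psi p lam m f i else 0

/-- Aperiodic cross-correlation of two length-`L` complex sequences at (integer) shift `τ`. -/
def corr (L : ℕ) (a b : ℕ → ℂ) (τ : ℤ) : ℂ :=
  ∑ i ∈ Finset.range L,
    if 0 ≤ (i : ℤ) + τ ∧ (i : ℤ) + τ < (L : ℤ) then
      a ((i : ℤ) + τ).toNat * (starRingEnd ℂ) (b i)
    else 0

theorem sum_digitVec (p m : ℕ) [NeZero p] (g : (Fin m → Fin p) → ℂ) :
    ∑ i ∈ Finset.range (p ^ m), g (digitVec p m i) = ∑ x, g x := by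
  rw [Finset.sum_range]
  refine Fintype.sum_equiv
    ((finFunctionFinEquiv (m := p) (n := m)).symm.trans (Equiv.arrowCongr Fin.revPerm (Equiv.refl _))) _ _ ?_
  intro i
  congr 1
  funext a
  apply Fin.ext
  simp [digitVec, Equiv.arrowCongr, finFunctionFinEquiv, Fin.val_rev]
  congr 3
  omega

theorem card_res {p m n : ℕ} (J : Fin n → Fin m) (hJ : Function.Injective J)
    (c : Fin n → Fin p) :
    (Finset.univ.filter (fun x : Fin m → Fin p => ∀ a, x (J a) = c a)).card = p ^ (m - n) := by
  classical
  have h : Finset.univ.filter (fun x : Fin m → Fin p => ∀ a, x (J a) = c a) =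
      Fintype.piFinset (fun i => Finset.univ.filter (fun v : Fin p => ∀ a, J a = i → v = c a)) := by
    ext x
    simp only [Finset.mem_filter, Finset.mem_univ, true_and, Fintype.mem_piFinset]
    constructor
    · rintro h i a rfl
      exact h a
    · intro h a
      exact h _ a rfl
  rw [h, Fintype.card_piFinset]
  have h2 : ∀ i, (Finset.univ.filter (fun v : Fin p => ∀ a, J a = i → v = c a)).card =
      if i ∈ Finset.univ.image J then 1 else p := by
    intro i
    split_ifs with hi
    · obtain ⟨b, -, rfl⟩ := Finset.mem_image.1 hi
      rw [Finset.card_eq_one]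
      refine ⟨c b, ?_⟩
      ext v
      simp only [Finset.mem_filter, Finset.mem_univ, true_and, Finset.mem_singleton]
      constructor
      · intro h
        exact h b rfl
      · intro h a ha
        rw [hJ ha, h]
    · rw [Finset.filter_true_of_mem, Finset.card_univ, Fintype.card_fin]
      intro v _ a ha
      exact absurd (Finset.mem_image.2 ⟨a, Finset.mem_univ _, ha⟩) hi
  rw [Finset.prod_congr rfl (fun i _ => h2 i), Finset.prod_ite]
  simp only [Finset.prod_const_one, one_mul, Finset.prod_const]
  congr 1
  have : Finset.univ.filter (fun i => i ∉ Finset.univ.image J) = (Finset.univ.image J)ᶜ := by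
    ext; simp
  rw [this, Finset.card_compl, Finset.card_image_of_injective _ hJ]
  simp

theorem pow_add_one_val {p : ℕ} [NeZero p] (η : ℂ) (h : η ^ p = 1) (v : Fin p) :
    η ^ ((v + 1 : Fin p) : ℕ) = η ^ (v : ℕ) * η := by
  rw [Fin.val_add, Fin.val_one', Nat.add_mod_mod, ← pow_succ]
  conv_rhs => rw [← Nat.mod_add_div (v + 1) p, pow_add, pow_mul, h, one_pow, mul_one]

theorem sum_zero {p m n : ℕ} [NeZero p] (J : Fin n → Fin m) (c : Fin n → Fin p) (l' : Fin m)
    (hl' : ¬∃ a, J a = l') (η : ℂ) (h : η ^ p = 1) (h1 : η ≠ 1) :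
    ∑ x : Fin m → Fin p, (if ∀ a, x (J a) = c a then η ^ (x l' : ℕ) else 0) = 0 := by
  classical
  set S := ∑ x : Fin m → Fin p, (if ∀ a, x (J a) = c a then η ^ (x l' : ℕ) else 0) with hS
  have : S = S * η := by
    conv_lhs => rw [hS, ← Equiv.sum_comp (Equiv.addRight (Pi.single l' (1 : Fin p)))]
    rw [hS, Finset.sum_mul]
    refine Finset.sum_congr rfl fun x _ => ?_
    have hx : ∀ a, x (J a) + (Pi.single l' (1 : Fin p) : Fin m → Fin p) (J a) = x (J a) := by
      intro a
      have : J a ≠ l' := fun h => hl' ⟨a, h⟩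
      simp [Pi.single_eq_of_ne this]
    simp only [Equiv.coe_addRight, Pi.add_apply, hx, ite_mul, zero_mul, Pi.single_eq_same, pow_add_one_val η h]
  have h2 : S * (η - 1) = 0 := by linear_combination -this
  exact (mul_eq_zero.1 h2).resolve_right (sub_ne_zero.2 h1)

theorem zeta_prim {lam : ℕ} (h : 0 < lam) : IsPrimitiveRoot (zeta lam) lam :=
  Complex.isPrimitiveRoot_exp lam h.ne'

theorem zeta_val_add {lam : ℕ} (h : 0 < lam) (a : ZMod lam) (N : ℕ) :
    zeta lam ^ (a + (N : ZMod lam)).val = zeta lam ^ a.val * zeta lam ^ N := by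
  have : NeZero lam := ⟨h.ne'⟩
  rw [← pow_add, ZMod.val_add, ZMod.val_natCast, Nat.add_mod_mod]
  conv_rhs => rw [← Nat.mod_add_div (a.val + N) lam, pow_add, pow_mul, (zeta_prim h).pow_eq_one, one_pow, mul_one]

theorem mul_conj_one {z : ℂ} {N : ℕ} (hN : N ≠ 0) (h : z ^ N = 1) : z * (starRingEnd ℂ) z = 1 := by
  rw [Complex.mul_conj, Complex.normSq_eq_norm_sq, Complex.norm_eq_one_of_pow_eq_one h hN]
  simp

theorem stmt16 {p lam m n : ℕ} [NeZero p] (hp : p.Prime)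
    (hlam : 0 < lam) (hdvd : p ∣ lam) (hm : 1 ≤ m) (hn : n ≤ m - 1)
    (f : (Fin m → Fin p) → ZMod lam)
    (J : Fin n → Fin m) (hJ : Function.Injective J)
    (k : ℕ) (hk1 : 1 ≤ k) (hk2 : k ≤ p - 1)
    (l l' : Fin m) (hl : ¬∃ a, J a = l) (hl' : ¬∃ a, J a = l')
    (c : Fin n → Fin p) (tn tn' : Fin p) :
    ∑ dn : Fin p,
      corr (p ^ m)
        (psiRes p lam m n
          (fun x => f x +
            ((lam / p * (k * (dn : ℕ) * (x l : ℕ) + (tn : ℕ) * (x l' : ℕ)) : ℕ) : ZMod lam))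
          J c)
        (psiRes p lam m n
          (fun x => f x +
            ((lam / p * (k * (dn : ℕ) * (x l : ℕ) + (tn' : ℕ) * (x l' : ℕ)) : ℕ) : ZMod lam))
          J c)
        0
      = if tn = tn' then ((p : ℂ) ^ (m - n + 1)) else 0 := by
  have hω : IsPrimitiveRoot (zeta lam ^ (lam / p)) p :=
    (zeta_prim hlam).pow hlam (Nat.div_mul_cancel hdvd).symm
  set ω := zeta lam ^ (lam / p) with hωd
  set η := ω ^ (tn : ℕ) * (starRingEnd ℂ) (ω ^ (tn' : ℕ)) with hη
  have hωp := hω.pow_eq_one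
  have hu : ∀ j : ℕ, ω ^ j * (starRingEnd ℂ) (ω ^ j) = 1 := fun j =>
    mul_conj_one hp.ne_zero (by rw [← pow_mul, mul_comm, pow_mul, hωp, one_pow])
  have hηp : η ^ p = 1 := by
    have : ∀ j : ℕ, (ω ^ j) ^ p = 1 := fun j => by rw [← pow_mul, mul_comm, pow_mul, hωp, one_pow]
    rw [hη, mul_pow, ← map_pow, this, this, map_one, one_mul]
  have key : ∀ dn : Fin p, corr (p ^ m)
        (psiRes p lam m n
          (fun x => f x +
            ((lam / p * (k * (dn : ℕ) * (x l : ℕ) + (tn : ℕ) * (x l' : ℕ)) : ℕ) : ZMod lam))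
          J c)
        (psiRes p lam m n
          (fun x => f x +
            ((lam / p * (k * (dn : ℕ) * (x l : ℕ) + (tn' : ℕ) * (x l' : ℕ)) : ℕ) : ZMod lam))
          J c)
        0 = ∑ x : Fin m → Fin p, (if ∀ a, x (J a) = c a then η ^ (x l' : ℕ) else 0) := by
    intro dn
    rw [← sum_digitVec, corr]
    refine Finset.sum_congr rfl fun i hi => ?_
    have hi' : (i : ℤ) < ((p ^ m : ℕ) : ℤ) := by exact_mod_cast Finset.mem_range.1 hi
    rw [if_pos (by constructor <;> omega)]
    simp only [add_zero, Int.toNat_natCast, psiRes, psi]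
    generalize digitVec p m i = x
    split_ifs with hx
    · rw [zeta_val_add hlam, zeta_val_add hlam, pow_mul, pow_mul, ← hωd, pow_add, pow_add]
      have h1 : zeta lam ^ (f x).val * (starRingEnd ℂ) (zeta lam ^ (f x).val) = 1 :=
        mul_conj_one hlam.ne' (by
          rw [← pow_mul, mul_comm, pow_mul, (zeta_prim hlam).pow_eq_one, one_pow])
      have h2 := hu (k * dn * x l)
      have h3 : η ^ (x l' : ℕ) = ω ^ ((tn : ℕ) * (x l' : ℕ)) *
          (starRingEnd ℂ) (ω ^ ((tn' : ℕ) * (x l' : ℕ))) := by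
        rw [hη, mul_pow, ← map_pow, pow_mul ω, pow_mul ω]
      rw [h3]
      rw [map_mul, map_mul]
      generalize (starRingEnd ℂ) (zeta lam ^ (f x).val) = A at *
      generalize (starRingEnd ℂ) (ω ^ (k * (dn : ℕ) * (x l : ℕ))) = B at *
      generalize (starRingEnd ℂ) (ω ^ ((tn' : ℕ) * (x l' : ℕ))) = C at *
      generalize ω ^ (k * (dn : ℕ) * (x l : ℕ)) = D at *
      generalize ω ^ ((tn : ℕ) * (x l' : ℕ)) = E at *
      generalize zeta lam ^ (f x).val = F at *
      linear_combination (D * B * E * C) * h1 + E * C * h2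
    · simp
  rw [Finset.sum_congr rfl fun dn _ => key dn, Finset.sum_const, Finset.card_univ, Fintype.card_fin]
  split_ifs with ht
  · have : η = 1 := by rw [hη, ht, hu]
    simp only [this, one_pow]
    rw [Finset.sum_boole, card_res J hJ c, nsmul_eq_mul, pow_succ]
    push_cast
    ring
  · rw [sum_zero J c l' hl' η hηp, smul_zero]
    intro h1
    apply ht
    apply Fin.ext
    refine hω.pow_inj tn.2 tn'.2 ?_
    have := hu tn'
    rw [hη] at h1
    have h0 : (starRingEnd ℂ) (ω ^ (tn' : ℕ)) ≠ 0 := right_ne_zero_of_mul_eq_one this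
    exact mul_right_cancel₀ h0 (h1.trans this.symm)
end QCCS
end
end
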